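/- arXiv:2011.06482 — 2 statements merged into one kernel-verified Lean document; each statement's English description precedes it below -/
import Mathlib

section
/- Let T be a finite tree with nonnegative vertex weights and total weight S, let ε ≥ 0, and let v be a vertex such that the forest T − v has a connected component T_max with total vertex weight strictly greater than S/2 + ε. Then every cut edge of T (with respect to ε) has both of its endpoints in T_max; in particular, if T is 2-splittable within error ε, any cut edge lies inside the component T_max. -/
open SimpleGraph

open scoped Classical

/-- The total weight of the connected component of `u` in the graph `G`. -/
noncomputable def compWeight {V : Type*} [Fintype V] (G : SimpleGraph V) (w : V → ℝ)
    (u : V) : ℝ :=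
  ∑ x ∈ Finset.univ.filter (fun x => G.Reachable u x), w x

/-- The graph obtained from `G` by deleting all edges incident with `v`
(so the components of `deleteVert G v` not containing `v` are exactly the
components of the forest `T - v`). -/
def deleteVert {V : Type*} (G : SimpleGraph V) (v : V) : SimpleGraph V :=
  G.deleteEdges (G.incidenceSet v)
/-- Deleting the edge `s(a, b)` from a graph leaves every vertex connected to `a` in the original
graph connected to one of the endpoints. -/
theorem reachable_deleteEdges_left_or_right {V : Type*} {G : SimpleGraph V} {a b x : V}
    (h : G.Reachable x a) :
    (G.deleteEdges {s(a, b)}).Reachable a x ∨ (G.deleteEdges {s(a, b)}).Reachable b x := by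
  obtain ⟨p⟩ := h
  induction p with
  | nil => exact Or.inl (Reachable.refl _)
  | @cons x y a hxy p ih =>
    by_cases he : s(x, y) = s(a, b)
    · rcases Sym2.eq_iff.mp he with ⟨rfl, -⟩ | ⟨rfl, -⟩
      · exact Or.inl (Reachable.refl _)
      · exact Or.inr (Reachable.refl _)
    · have hyx : (G.deleteEdges {s(a, b)}).Reachable y x :=
        (Adj.reachable (deleteEdges_adj.mpr ⟨hxy, he⟩)).symm
      exact ih.imp (·.trans hyx) (·.trans hyx)

/-- A component of a subgraph `H ≤ G` that does not contain both `a` and `b` stays connected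
in `G` after deleting the edge `s(a, b)`. -/
theorem reachable_deleteEdges_of_not_both {V : Type*} {G H : SimpleGraph V} (hHG : H ≤ G)
    {a b m x : V} (hab : ¬(H.Reachable m a ∧ H.Reachable m b)) (h : H.Reachable m x) :
    (G.deleteEdges {s(a, b)}).Reachable m x := by
  obtain ⟨p⟩ := h
  induction p with
  | nil => exact Reachable.refl _
  | @cons m y x hmy p ih =>
    have hne : s(m, y) ≠ s(a, b) := by
      intro he
      rcases Sym2.eq_iff.mp he with ⟨rfl, rfl⟩ | ⟨rfl, rfl⟩
      · exact hab ⟨Reachable.refl _, hmy.reachable⟩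
      · exact hab ⟨hmy.reachable, Reachable.refl _⟩
    exact (Adj.reachable (deleteEdges_adj.mpr ⟨hHG hmy, hne⟩)).trans
      (ih fun h => hab ⟨hmy.reachable.trans h.1, hmy.reachable.trans h.2⟩)

theorem compWeight_le_compWeight {V : Type*} [Fintype V] {G H : SimpleGraph V} {w : V → ℝ}
    (hw : ∀ x, 0 ≤ w x) {u m : V} (h : ∀ x, H.Reachable m x → G.Reachable u x) :
    compWeight H w m ≤ compWeight G w u :=
  Finset.sum_le_sum_of_subset_of_nonneg (Finset.monotone_filter_right _ fun x _ => h x)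
    fun x _ _ => hw x

/-- If some component `T_max` of `T - v` (the component of a vertex `m ≠ v`) has
total weight strictly greater than `S/2 + ε`, then every cut edge of `T` has both
endpoints in `T_max`. -/
theorem cut_edge_in_heavy_component {V : Type*} [Fintype V]
    (T : SimpleGraph V) (hT : T.IsTree) (w : V → ℝ) (hw : ∀ x, 0 ≤ w x)
    (ε : ℝ) (hε : 0 ≤ ε) (S : ℝ) (hS : S = ∑ x, w x)
    (v m : V) (hm : m ≠ v)
    (hmax : S / 2 + ε < compWeight (deleteVert T v) w m) :
    ∀ a b : V, T.Adj a b →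
      (S / 2 - ε ≤ compWeight (T.deleteEdges {s(a, b)}) w a ∧
          compWeight (T.deleteEdges {s(a, b)}) w a ≤ S / 2 + ε ∧
          S / 2 - ε ≤ compWeight (T.deleteEdges {s(a, b)}) w b ∧
          compWeight (T.deleteEdges {s(a, b)}) w b ≤ S / 2 + ε) →
      (deleteVert T v).Reachable m a ∧ (deleteVert T v).Reachable m b := by
  rintro a b - ⟨-, ha, -, hb⟩
  by_contra hab
  have hC : ∀ x, (deleteVert T v).Reachable m x → (T.deleteEdges {s(a, b)}).Reachable m x :=
    fun x => reachable_deleteEdges_of_not_both (T.deleteEdges_le _) hab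
  rcases reachable_deleteEdges_left_or_right (b := b) (hT.connected.preconnected m a)
    with h | h
  · exact (hmax.trans_le (compWeight_le_compWeight hw fun x hx => h.trans (hC x hx))).not_ge ha
  · exact (hmax.trans_le (compWeight_le_compWeight hw fun x hx => h.trans (hC x hx))).not_ge hb
end

section
/- Let T be a finite tree with nonnegative vertex weights and total weight S, let ε ≥ 0, and suppose T is not 2-splittable within error ε. If v is a vertex such that the forest T − v has a connected component T_max with total vertex weight strictly greater than S/2 + ε, then there exists a vertex v' in T_max such that every connected component of the forest T − v' has total vertex weight strictly less than S/2 − ε. -/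
open SimpleGraph

open scoped Classical

/-- In the graph with the edge `ab` deleted, every vertex is reachable from `a` or `b`. -/
lemma reachable_or_reachable_deleteEdges {V : Type*} {T : SimpleGraph V} (hT : T.Connected)
    (a b x : V) : (T.deleteEdges {s(a, b)}).Reachable a x ∨
      (T.deleteEdges {s(a, b)}).Reachable b x := by
  have h := (reachable_iff_reflTransGen a x).1 (hT.preconnected a x)
  induction h with
  | refl => exact Or.inl .rfl
  | @tail y z _ hyz ih =>
    by_cases he : s(y, z) = s(a, b)
    · rcases Sym2.eq_iff.1 he with ⟨_, rfl⟩ | ⟨_, rfl⟩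
      · exact Or.inr .rfl
      · exact Or.inl .rfl
    · have hadj : (T.deleteEdges {s(a, b)}).Adj y z := deleteEdges_adj.2 ⟨hyz, he⟩
      exact ih.imp (·.trans hadj.reachable) (·.trans hadj.reachable)

lemma not_reachable_deleteEdges_of_adj {V : Type*} {T : SimpleGraph V} (hT : T.IsAcyclic)
    {a b : V} (hab : T.Adj a b) : ¬ (T.deleteEdges {s(a, b)}).Reachable a b :=
  isBridge_iff.1 (isAcyclic_iff_forall_adj_isBridge.1 hT hab)

lemma compWeight_add_compWeight_deleteEdges {V : Type*} [Fintype V] {T : SimpleGraph V}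
    (hT : T.IsTree) (w : V → ℝ) {a b : V} (hab : T.Adj a b) :
    compWeight (T.deleteEdges {s(a, b)}) w a + compWeight (T.deleteEdges {s(a, b)}) w b =
      ∑ x, w x := by
  simp only [compWeight, Finset.sum_filter, ← Finset.sum_add_distrib]
  refine Finset.sum_congr rfl fun x _ => ?_
  by_cases hax : (T.deleteEdges {s(a, b)}).Reachable a x
  · have hbx : ¬ (T.deleteEdges {s(a, b)}).Reachable b x := fun hbx =>
      not_reachable_deleteEdges_of_adj hT.isAcyclic hab (hax.trans hbx.symm)
    rw [if_pos hax, if_neg hbx, add_zero]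
  · have hbx := (reachable_or_reachable_deleteEdges hT.connected a b x).resolve_left hax
    rw [if_neg hax, if_pos hbx, zero_add]

lemma deleteVert_adj {V : Type*} {T : SimpleGraph V} {v x y : V} :
    (deleteVert T v).Adj x y ↔ T.Adj x y ∧ x ≠ v ∧ y ≠ v := by
  rw [deleteVert, deleteEdges_adj, and_congr_right_iff]
  intro h
  rw [mk'_mem_incidenceSet_iff]
  grind

lemma deleteVert_le_deleteEdges {V : Type*} (T : SimpleGraph V) (b c : V) :
    deleteVert T b ≤ T.deleteEdges {s(b, c)} := by
  intro x y h
  obtain ⟨hxy, hx, hy⟩ := deleteVert_adj.1 h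
  refine deleteEdges_adj.2 ⟨hxy, fun he => ?_⟩
  rcases Sym2.eq_iff.1 he with ⟨rfl, _⟩ | ⟨_, rfl⟩ <;> contradiction

/-- In an acyclic graph, deleting the edge `bc` or the vertex `b` leaves the same component
of `c`. -/
lemma reachable_deleteEdges_iff_deleteVert {V : Type*} {T : SimpleGraph V} (hT : T.IsAcyclic)
    {b c : V} (hbc : T.Adj b c) (x : V) :
    (T.deleteEdges {s(b, c)}).Reachable c x ↔ (deleteVert T b).Reachable c x := by
  refine ⟨fun h => ?_, fun h => h.mono (deleteVert_le_deleteEdges T b c)⟩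
  have hne : ∀ {z}, (T.deleteEdges {s(b, c)}).Reachable c z → z ≠ b := by
    rintro z hz rfl
    exact not_reachable_deleteEdges_of_adj hT hbc hz.symm
  rw [reachable_iff_reflTransGen] at h
  induction h with
  | refl => exact .rfl
  | @tail y z hy hyz ih =>
    have hcy := (reachable_iff_reflTransGen c y).2 hy
    exact ih.trans (deleteVert_adj.2 ⟨(deleteEdges_adj.1 hyz).1, hne hcy,
      hne (hcy.trans hyz.reachable)⟩).reachable

/-- Every component of a connected graph minus `b` contains a neighbour of `b`. -/
lemma exists_adj_reachable_deleteVert {V : Type*} {T : SimpleGraph V} (hT : T.Connected)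
    {b u : V} (hu : u ≠ b) : ∃ c, T.Adj b c ∧ (deleteVert T b).Reachable u c := by
  have h := (reachable_iff_reflTransGen u b).1 (hT.preconnected u b)
  induction h using Relation.ReflTransGen.head_induction_on with
  | refl => exact absurd rfl hu
  | @head y z hyz _ ih =>
    by_cases hz : z = b
    · exact ⟨y, hz ▸ hyz.symm, .rfl⟩
    · obtain ⟨c, hc, hzc⟩ := ih hz
      exact ⟨c, hc, (deleteVert_adj.2 ⟨hyz, hu, hz⟩).reachable.trans hzc⟩

lemma compWeight_congr {V : Type*} [Fintype V] {G H : SimpleGraph V} (w : V → ℝ) {u c : V}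
    (h : ∀ x, G.Reachable u x ↔ H.Reachable c x) : compWeight G w u = compWeight H w c := by
  simp only [compWeight, h]

/-- Every component of a tree minus `b` is the far side of an edge at `b`. -/
lemma exists_adj_reachable_deleteVert_iff {V : Type*} {T : SimpleGraph V} (hT : T.IsTree)
    {b u : V} (hu : u ≠ b) : ∃ c, T.Adj b c ∧
      ∀ x, (deleteVert T b).Reachable u x ↔ (T.deleteEdges {s(b, c)}).Reachable c x := by
  obtain ⟨c, hbc, huc⟩ := exists_adj_reachable_deleteVert hT.connected hu
  refine ⟨c, hbc, fun x => ?_⟩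
  rw [reachable_deleteEdges_iff_deleteVert hT.isAcyclic hbc]
  exact ⟨huc.symm.trans, huc.trans⟩

/-- The far side of an edge `bc` is contained in the far side of a preceding edge `ab`. -/
lemma reachable_deleteEdges_of_reachable_deleteEdges {V : Type*} {T : SimpleGraph V}
    (hT : T.IsAcyclic) {a b c x : V} (hbc : T.Adj b c) (hca : c ≠ a)
    (h : (T.deleteEdges {s(b, c)}).Reachable c x) :
    (T.deleteEdges {s(a, b)}).Reachable b x := by
  have hadj : (T.deleteEdges {s(a, b)}).Adj b c := by
    refine deleteEdges_adj.2 ⟨hbc, fun he => ?_⟩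
    rcases Sym2.eq_iff.1 he with ⟨_, hcb⟩ | ⟨_, hc⟩
    · exact hbc.ne hcb.symm
    · exact hca hc
  rw [reachable_deleteEdges_iff_deleteVert hT hbc] at h
  rw [Sym2.eq_swap] at hadj ⊢
  exact hadj.reachable.trans (h.mono (deleteVert_le_deleteEdges T b a))

/-- Suppose `T` is not 2-splittable within error `ε` (it has no cut edge) and some
component `T_max` of `T - v` (the component of a vertex `m ≠ v`) has total weight
strictly greater than `S/2 + ε`.  Then there is a vertex `v'` in `T_max` such that
every component of `T - v'` has total weight strictly less than `S/2 - ε`. -/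
theorem exists_witness_vertex_in_heavy_component {V : Type*} [Fintype V]
    (T : SimpleGraph V) (hT : T.IsTree) (w : V → ℝ) (hw : ∀ x, 0 ≤ w x)
    (ε : ℝ) (hε : 0 ≤ ε) (S : ℝ) (hS : S = ∑ x, w x)
    (hnosplit : ¬ ∃ a b : V, T.Adj a b ∧
        S / 2 - ε ≤ compWeight (T.deleteEdges {s(a, b)}) w a ∧
        compWeight (T.deleteEdges {s(a, b)}) w a ≤ S / 2 + ε ∧
        S / 2 - ε ≤ compWeight (T.deleteEdges {s(a, b)}) w b ∧
        compWeight (T.deleteEdges {s(a, b)}) w b ≤ S / 2 + ε)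
    (v m : V) (hm : m ≠ v)
    (hmax : S / 2 + ε < compWeight (deleteVert T v) w m) :
    ∃ v' : V, (deleteVert T v).Reachable m v' ∧
      ∀ u, u ≠ v' → compWeight (deleteVert T v') w u < S / 2 - ε := by
  have hheavy : ∀ {a b : V}, T.Adj a b →
      S / 2 - ε ≤ compWeight (T.deleteEdges {s(a, b)}) w b →
      S / 2 + ε < compWeight (T.deleteEdges {s(a, b)}) w b := by
    intro a b hab h
    by_contra! hle
    have hsum := compWeight_add_compWeight_deleteEdges hT w hab
    exact hnosplit ⟨a, b, hab, by linarith, by linarith, h, hle⟩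
  have hdescent : ∀ (n : ℕ) (a b : V), T.Adj a b →
      (Finset.univ.filter fun x => (T.deleteEdges {s(a, b)}).Reachable b x).card = n →
      S / 2 + ε < compWeight (T.deleteEdges {s(a, b)}) w b →
      (∀ x, (T.deleteEdges {s(a, b)}).Reachable b x → (deleteVert T v).Reachable m x) →
      ∃ v' : V, (deleteVert T v).Reachable m v' ∧
        ∀ u, u ≠ v' → compWeight (deleteVert T v') w u < S / 2 - ε := by
    intro n
    induction n using Nat.strong_induction_on with
    | _ n ih =>
      intro a b hab hn hlarge hsub
      by_contra! hcon
      obtain ⟨u, hu, hle⟩ := hcon b (hsub b .rfl)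
      obtain ⟨c, hbc, hiff⟩ := exists_adj_reachable_deleteVert_iff hT hu
      rw [compWeight_congr w hiff] at hle
      by_cases hca : c = a
      · subst hca
        have hsum := compWeight_add_compWeight_deleteEdges hT w hab
        rw [Sym2.eq_swap] at hle
        linarith
      · have hmono := fun x (h : (T.deleteEdges {s(b, c)}).Reachable c x) =>
          reachable_deleteEdges_of_reachable_deleteEdges (a := a) hT.isAcyclic hbc hca h
        have hcard : (Finset.univ.filter fun x =>
            (T.deleteEdges {s(b, c)}).Reachable c x).card < n := by
          rw [← hn]
          refine Finset.card_lt_card (Finset.ssubset_iff_of_subset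
            (Finset.monotone_filter_right _ fun x _ => hmono x) |>.2 ⟨b, by simp, ?_⟩)
          simpa using fun h =>
            not_reachable_deleteEdges_of_adj hT.isAcyclic hbc (Reachable.symm h)
        obtain ⟨v', hv', hlt⟩ := ih _ hcard b c hbc rfl (hheavy hbc hle)
          fun x h => hsub x (hmono x h)
        obtain ⟨u', hu', hle'⟩ := hcon v' hv'
        exact (hlt u' hu').not_ge hle'
  obtain ⟨c, hvc, hiff⟩ := exists_adj_reachable_deleteVert_iff hT hm
  rw [compWeight_congr w hiff] at hmax
  exact hdescent _ v c hvc rfl hmax fun x => (hiff x).2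
end
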